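/- Let (λ_j)_{j≥0} be a nondecreasing sequence of nonnegative real numbers tending to infinity such that the series Σ_j e^{-t λ_j} converges for every t > 0, and suppose that lim_{t→0⁺} t · Σ_j e^{-t λ_j} = B for some real number B. Then the eigenvalue counting function N(λ) = #{ j : λ_j ≤ λ } satisfies N(λ)/λ → B as λ → ∞. -/

import Mathlib

open Filter Topology

section HeatSums

variable {lam : ℕ → ℝ} {B : ℝ}

/-- The sum `t ∑ e^{-tλ_j} h(e^{-tλ_j})`, a weighted version of the heat trace. -/
noncomputable def weightedHeatSum (lam : ℕ → ℝ) (h : ℝ → ℝ) (t : ℝ) : ℝ :=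
  t * ∑' j, Real.exp (-t * lam j) * h (Real.exp (-t * lam j))

lemma exp_neg_mul_mem_Icc (hpos : ∀ j, 0 ≤ lam j) {t : ℝ} (ht : 0 < t) (j : ℕ) :
    Real.exp (-t * lam j) ∈ Set.Icc (0 : ℝ) 1 := by
  refine ⟨(Real.exp_pos _).le, Real.exp_le_one_iff.2 ?_⟩
  have := mul_nonneg ht.le (hpos j)
  linarith

lemma summable_exp_mul_of_continuous (hpos : ∀ j, 0 ≤ lam j)
    (hsum : ∀ t : ℝ, 0 < t → Summable fun j => Real.exp (-t * lam j))
    {h : ℝ → ℝ} (hh : Continuous h) {t : ℝ} (ht : 0 < t) :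
    Summable fun j => Real.exp (-t * lam j) * h (Real.exp (-t * lam j)) := by
  obtain ⟨C, hC⟩ := (isCompact_Icc (a := (0 : ℝ)) (b := 1)).exists_bound_of_continuousOn
    hh.continuousOn
  refine Summable.of_norm_bounded ((hsum t ht).mul_right C) fun j => ?_
  rw [norm_mul, Real.norm_of_nonneg (Real.exp_pos _).le]
  exact mul_le_mul_of_nonneg_left (hC _ (exp_neg_mul_mem_Icc hpos ht j)) (Real.exp_pos _).le

lemma tendsto_weightedHeatSum_polynomial (hpos : ∀ j, 0 ≤ lam j)
    (hsum : ∀ t : ℝ, 0 < t → Summable fun j => Real.exp (-t * lam j))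
    (hlim : Tendsto (fun t : ℝ => t * ∑' j, Real.exp (-t * lam j)) (𝓝[>] 0) (𝓝 B))
    (p : Polynomial ℝ) :
    Tendsto (weightedHeatSum lam fun u => p.eval u) (𝓝[>] 0)
      (𝓝 (B * ∫ u in (0 : ℝ)..1, p.eval u)) := by
  induction p using Polynomial.induction_on' with
  | add p q hp hq =>
    have hint : (∫ u in (0 : ℝ)..1, (p + q).eval u)
        = (∫ u in (0 : ℝ)..1, p.eval u) + ∫ u in (0 : ℝ)..1, q.eval u := by
      simp only [Polynomial.eval_add]
      exact intervalIntegral.integral_add (p.continuous.intervalIntegrable _ _)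
        (q.continuous.intervalIntegrable _ _)
    rw [hint, mul_add]
    refine (hp.add hq).congr' ?_
    filter_upwards [self_mem_nhdsWithin] with t ht
    simp only [weightedHeatSum, Polynomial.eval_add, mul_add]
    rw [(summable_exp_mul_of_continuous hpos hsum p.continuous ht).tsum_add
      (summable_exp_mul_of_continuous hpos hsum q.continuous ht), mul_add]
  | monomial n a =>
    have hn : (0 : ℝ) < n + 1 := by positivity
    have hscale : Tendsto (fun t : ℝ => ((n : ℝ) + 1) * t) (𝓝[>] 0) (𝓝[>] 0) := by
      refine tendsto_nhdsWithin_iff.2 ⟨?_, ?_⟩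
      · have : Tendsto (fun t : ℝ => ((n : ℝ) + 1) * t) (𝓝 0) (𝓝 (((n : ℝ) + 1) * 0)) :=
          tendsto_id.const_mul _
        rw [mul_zero] at this
        exact this.mono_left nhdsWithin_le_nhds
      · filter_upwards [self_mem_nhdsWithin] with t ht
        exact mul_pos hn ht
    have hint : B * (∫ u in (0 : ℝ)..1, (Polynomial.monomial n a).eval u)
        = a / (n + 1) * B := by
      simp only [Polynomial.eval_monomial, intervalIntegral.integral_const_mul, integral_pow]
      simp
      ring
    rw [hint]
    refine ((hlim.comp hscale).const_mul (a / (n + 1))).congr fun t => ?_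
    have hterm : ∀ j, Real.exp (-t * lam j) * (a * Real.exp (-t * lam j) ^ n)
        = a * Real.exp (-((n + 1) * t) * lam j) := by
      intro j
      rw [show -(((n : ℝ) + 1) * t) * lam j = ((n + 1 : ℕ) : ℝ) * (-t * lam j) by
        push_cast; ring, Real.exp_nat_mul]
      ring
    simp only [weightedHeatSum, Polynomial.eval_monomial, Function.comp_apply, hterm,
      tsum_mul_left]
    field_simp

lemma abs_weightedHeatSum_sub_le (hpos : ∀ j, 0 ≤ lam j)
    (hsum : ∀ t : ℝ, 0 < t → Summable fun j => Real.exp (-t * lam j))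
    {f g : ℝ → ℝ} (hf : Continuous f) (hg : Continuous g) {δ : ℝ}
    (hfg : ∀ u ∈ Set.Icc (0 : ℝ) 1, |f u - g u| ≤ δ) {t : ℝ} (ht : 0 < t) :
    |weightedHeatSum lam f t - weightedHeatSum lam g t|
      ≤ δ * (t * ∑' j, Real.exp (-t * lam j)) := by
  have hbound : ‖∑' j, (Real.exp (-t * lam j) * f (Real.exp (-t * lam j))
      - Real.exp (-t * lam j) * g (Real.exp (-t * lam j)))‖
      ≤ ∑' j, Real.exp (-t * lam j) * δ := by
    refine tsum_of_norm_bounded ((hsum t ht).mul_right δ).hasSum fun j => ?_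
    rw [← mul_sub, norm_mul, Real.norm_of_nonneg (Real.exp_pos _).le]
    exact mul_le_mul_of_nonneg_left (hfg _ (exp_neg_mul_mem_Icc hpos ht j)) (Real.exp_pos _).le
  rw [tsum_mul_right, Real.norm_eq_abs] at hbound
  rw [weightedHeatSum, weightedHeatSum, ← mul_sub,
    ← (summable_exp_mul_of_continuous hpos hsum hf ht).tsum_sub
      (summable_exp_mul_of_continuous hpos hsum hg ht), abs_mul, abs_of_pos ht]
  calc _ ≤ t * ((∑' j, Real.exp (-t * lam j)) * δ) := mul_le_mul_of_nonneg_left hbound ht.le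
    _ = _ := by ring

lemma tendsto_weightedHeatSum (hpos : ∀ j, 0 ≤ lam j)
    (hsum : ∀ t : ℝ, 0 < t → Summable fun j => Real.exp (-t * lam j))
    (hlim : Tendsto (fun t : ℝ => t * ∑' j, Real.exp (-t * lam j)) (𝓝[>] 0) (𝓝 B))
    {h : ℝ → ℝ} (hh : Continuous h) :
    Tendsto (weightedHeatSum lam h) (𝓝[>] 0) (𝓝 (B * ∫ u in (0 : ℝ)..1, h u)) := by
  rw [Metric.tendsto_nhds]
  intro ε hε
  have hM : 0 < |B| + 1 := by positivity
  set δ := ε / (3 * (|B| + 1)) with hδ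
  have hδpos : 0 < δ := by positivity
  have hδM : δ * (|B| + 1) = ε / 3 := by rw [hδ]; field_simp
  obtain ⟨p, hp⟩ := exists_polynomial_near_of_continuousOn 0 1 h hh.continuousOn δ hδpos
  have hint : |(∫ u in (0 : ℝ)..1, p.eval u) - ∫ u in (0 : ℝ)..1, h u| ≤ δ := by
    rw [← intervalIntegral.integral_sub (p.continuous.intervalIntegrable _ _)
      (hh.intervalIntegrable _ _)]
    have := intervalIntegral.norm_integral_le_of_norm_le_const (a := 0) (b := 1) (C := δ)
      (f := fun u => p.eval u - h u) fun u hu => by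
        rw [Set.uIoc_of_le zero_le_one] at hu
        exact (hp u (Set.Ioc_subset_Icc_self hu)).le
    simpa using this
  have hmul : |B * (∫ u in (0 : ℝ)..1, p.eval u) - B * ∫ u in (0 : ℝ)..1, h u| ≤ ε / 3 := by
    rw [← mul_sub, abs_mul, ← hδM, mul_comm δ]
    exact mul_le_mul (by linarith) hint (abs_nonneg _) hM.le
  filter_upwards [self_mem_nhdsWithin,
    Metric.tendsto_nhds.1 (tendsto_weightedHeatSum_polynomial hpos hsum hlim p) (ε / 3)
      (by positivity),
    hlim.eventually_lt_const (show B < |B| + 1 by linarith [le_abs_self B])] with t ht hpt hBt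
  rw [Real.dist_eq] at hpt ⊢
  have happrox := abs_weightedHeatSum_sub_le hpos hsum hh p.continuous
    (fun u hu => by rw [abs_sub_comm]; exact (hp u hu).le) ht
  have hlast := mul_le_mul_of_nonneg_left hBt.le hδpos.le
  rw [hδM] at hlast
  rw [abs_lt] at hpt ⊢
  rw [abs_le] at happrox hmul
  constructor <;> linarith [happrox.1, happrox.2, hmul.1, hmul.2, hpt.1, hpt.2]

end HeatSums

/-- A continuous function vanishing on `(-∞, a]` and equal to `1 / u` on `[b, ∞)`. -/
noncomputable def invRamp (a b u : ℝ) : ℝ :=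
  max 0 (min 1 ((u - a) / (b - a))) / max u a

section InvRamp

variable {a b u : ℝ}

lemma continuous_invRamp (ha : 0 < a) : Continuous (invRamp a b) := by
  unfold invRamp
  refine Continuous.div (by fun_prop) (by fun_prop) fun u => ?_
  exact (ha.trans_le (le_max_right u a)).ne'

lemma invRamp_nonneg (ha : 0 < a) : 0 ≤ invRamp a b u :=
  div_nonneg (le_max_left _ _) (ha.le.trans (le_max_right _ _))

lemma invRamp_of_le (hab : a < b) (hu : u ≤ a) : invRamp a b u = 0 := by
  have : (u - a) / (b - a) ≤ 0 := div_nonpos_of_nonpos_of_nonneg (by linarith) (by linarith)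
  rw [invRamp, max_eq_left ((min_le_right _ _).trans this), zero_div]

lemma invRamp_of_ge (hab : a < b) (hu : b ≤ u) : invRamp a b u = u⁻¹ := by
  have : 1 ≤ (u - a) / (b - a) := (one_le_div (by linarith)).2 (by linarith)
  rw [invRamp, min_eq_left this, max_eq_right zero_le_one, max_eq_left (hab.le.trans hu),
    one_div]

lemma invRamp_le_inv (ha : 0 < a) (hu : a ≤ u) : invRamp a b u ≤ u⁻¹ := by
  rw [invRamp, max_eq_left hu, ← one_div]
  exact div_le_div_of_nonneg_right (max_le zero_le_one (min_le_left _ _)) (ha.le.trans hu)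

lemma mul_invRamp_le_one (ha : 0 < a) (hab : a < b) (hu : 0 < u) : u * invRamp a b u ≤ 1 := by
  rcases le_total u a with h | h
  · simp [invRamp_of_le hab h]
  · calc u * invRamp a b u ≤ u * u⁻¹ :=
        mul_le_mul_of_nonneg_left (invRamp_le_inv ha h) hu.le
      _ = 1 := mul_inv_cancel₀ hu.ne'

lemma integral_invRamp_le (ha : 0 < a) (hab : a < b) (ha1 : a ≤ 1) :
    ∫ u in (0 : ℝ)..1, invRamp a b u ≤ -Real.log a := by
  have hc := continuous_invRamp (b := b) ha
  have hzero : ∫ u in (0 : ℝ)..a, invRamp a b u = 0 := by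
    refine (intervalIntegral.integral_congr (g := fun _ => 0) fun u hu => ?_).trans (by simp)
    rw [Set.uIcc_of_le ha.le] at hu
    exact invRamp_of_le hab hu.2
  have hinv : IntervalIntegrable (fun u : ℝ => u⁻¹) MeasureTheory.volume a 1 :=
    intervalIntegral.intervalIntegrable_inv
      (fun u hu => by rw [Set.uIcc_of_le ha1] at hu; exact (ha.trans_le hu.1).ne')
      continuousOn_id
  rw [← intervalIntegral.integral_add_adjacent_intervals (hc.intervalIntegrable 0 a)
    (hc.intervalIntegrable a 1), hzero, zero_add]
  calc _ ≤ ∫ u in a..1, u⁻¹ := intervalIntegral.integral_mono_on ha1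
        (hc.intervalIntegrable _ _) hinv fun u hu => invRamp_le_inv ha hu.1
    _ = -Real.log a := by
      rw [integral_inv_of_pos ha one_pos, one_div, Real.log_inv]

lemma le_integral_invRamp (ha : 0 < a) (hab : a < b) (hb1 : b ≤ 1) :
    -Real.log b ≤ ∫ u in (0 : ℝ)..1, invRamp a b u := by
  have hc := continuous_invRamp (b := b) ha
  have hb := ha.trans hab
  have hright : ∫ u in b..1, invRamp a b u = -Real.log b := by
    rw [← Real.log_inv, ← one_div, ← integral_inv_of_pos hb one_pos]
    refine intervalIntegral.integral_congr fun u hu => ?_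
    rw [Set.uIcc_of_le hb1] at hu
    exact invRamp_of_ge hab hu.1
  rw [← intervalIntegral.integral_add_adjacent_intervals (hc.intervalIntegrable 0 b)
    (hc.intervalIntegrable b 1), hright]
  have := intervalIntegral.integral_nonneg (μ := MeasureTheory.volume) hb.le
    fun u _ => invRamp_nonneg (b := b) (u := u) ha
  linarith

end InvRamp

section Counting

variable {lam : ℕ → ℝ} {x a b : ℝ}

lemma finite_setOf_le_of_tendsto_atTop (htop : Tendsto lam atTop atTop) (x : ℝ) :
    {j : ℕ | lam j ≤ x}.Finite := by
  have := htop.eventually_gt_atTop x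
  rw [← Nat.cofinite_eq_atTop, eventually_cofinite] at this
  simpa using this

lemma exp_neg_one_le_exp_iff (hx : 0 < x) (y : ℝ) :
    Real.exp (-1) ≤ Real.exp (-x⁻¹ * y) ↔ y ≤ x := by
  rw [Real.exp_le_exp, neg_mul, neg_le_neg_iff, inv_mul_le_iff₀ hx, mul_one]

lemma card_div_le_weightedHeatSum (hpos : ∀ j, 0 ≤ lam j) (htop : Tendsto lam atTop atTop)
    (hsum : ∀ t : ℝ, 0 < t → Summable fun j => Real.exp (-t * lam j))
    (hx : 0 < x) (ha : 0 < a) (hae : a < Real.exp (-1)) :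
    (Nat.card {j : ℕ | lam j ≤ x} : ℝ) / x
      ≤ weightedHeatSum lam (invRamp a (Real.exp (-1))) x⁻¹ := by
  have hfin := finite_setOf_le_of_tendsto_atTop htop x
  rw [Nat.card_coe_set_eq, Set.ncard_eq_toFinset_card _ hfin, weightedHeatSum, div_eq_inv_mul]
  refine mul_le_mul_of_nonneg_left ?_ (inv_pos.2 hx).le
  refine le_trans ?_ ((summable_exp_mul_of_continuous hpos hsum (continuous_invRamp ha)
    (inv_pos.2 hx)).sum_le_tsum hfin.toFinset
      fun j _ => mul_nonneg (Real.exp_pos _).le (invRamp_nonneg ha))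
  rw [Finset.card_eq_sum_ones, Nat.cast_sum]
  refine Finset.sum_le_sum fun j hj => ?_
  have hj' : lam j ≤ x := by simpa using hj
  rw [invRamp_of_ge hae ((exp_neg_one_le_exp_iff hx _).2 hj'),
    mul_inv_cancel₀ (Real.exp_pos _).ne', Nat.cast_one]

lemma weightedHeatSum_le_card_div (htop : Tendsto lam atTop atTop)
    (hx : 0 < x) (hb : Real.exp (-1) < b) :
    weightedHeatSum lam (invRamp (Real.exp (-1)) b) x⁻¹
      ≤ (Nat.card {j : ℕ | lam j ≤ x} : ℝ) / x := by
  have hfin := finite_setOf_le_of_tendsto_atTop htop x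
  rw [Nat.card_coe_set_eq, Set.ncard_eq_toFinset_card _ hfin, weightedHeatSum, div_eq_inv_mul]
  refine mul_le_mul_of_nonneg_left ?_ (inv_pos.2 hx).le
  rw [tsum_eq_sum (s := hfin.toFinset), Finset.card_eq_sum_ones, Nat.cast_sum]
  · refine Finset.sum_le_sum fun j _ => ?_
    rw [Nat.cast_one]
    exact mul_invRamp_le_one (Real.exp_pos _) hb (Real.exp_pos _)
  · intro j hj
    have hj' : ¬ lam j ≤ x := by simpa using hj
    rw [← exp_neg_one_le_exp_iff hx, not_le] at hj'
    rw [invRamp_of_le hb hj'.le, mul_zero]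

end Counting

/-- Karamata's Tauberian theorem (in the form used in the paper): if `λ_j` is a
nondecreasing sequence of nonnegative reals tending to infinity, `∑ e^{-t λ_j}`
converges for every `t > 0`, and `t · ∑_j e^{-t λ_j} → B` as `t → 0⁺`, then the
eigenvalue counting function satisfies `N(λ)/λ → B` as `λ → ∞`. -/
theorem karamata_counting_of_heat_trace
    (lam : ℕ → ℝ) (B : ℝ)
    (hmono : Monotone lam)
    (hpos : ∀ j, 0 ≤ lam j)
    (htop : Tendsto lam atTop atTop)
    (hsum : ∀ t : ℝ, 0 < t → Summable fun j => Real.exp (-t * lam j))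
    (hlim : Tendsto (fun t : ℝ => t * ∑' j, Real.exp (-t * lam j))
      (nhdsWithin 0 (Set.Ioi 0)) (nhds B)) :
    Tendsto (fun x : ℝ => (Nat.card {j : ℕ | lam j ≤ x} : ℝ) / x)
      atTop (nhds B) := by
  have hB : 0 ≤ B := by
    refine ge_of_tendsto hlim ?_
    filter_upwards [self_mem_nhdsWithin] with t ht
    exact mul_nonneg (le_of_lt ht) (tsum_nonneg fun j => (Real.exp_pos _).le)
  have hlog : Tendsto (fun a => B * -Real.log a) (𝓝 (Real.exp (-1))) (𝓝 B) := by
    have := ((Real.continuousAt_log (Real.exp_pos (-1)).ne').tendsto.neg).const_mul B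
    simpa using this
  have hlt1 : Real.exp (-1) < 1 := Real.exp_lt_one_iff.2 (by norm_num)
  have key {a b : ℝ} (ha : 0 < a) :
      Tendsto (fun x : ℝ => weightedHeatSum lam (invRamp a b) x⁻¹) atTop
        (𝓝 (B * ∫ u in (0 : ℝ)..1, invRamp a b u)) :=
    (tendsto_weightedHeatSum hpos hsum hlim (continuous_invRamp ha)).comp
      tendsto_inv_atTop_nhdsGT_zero
  refine tendsto_order.2 ⟨fun r hr => ?_, fun r hr => ?_⟩
  · obtain ⟨b, hbr, hb1, hb⟩ := (((hlog.mono_left nhdsWithin_le_nhds).eventually_const_lt hr).and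
      ((eventually_lt_nhds hlt1).filter_mono nhdsWithin_le_nhds |>.and
        (self_mem_nhdsWithin (s := Set.Ioi (Real.exp (-1)))))).exists
    have hint := mul_le_mul_of_nonneg_left
      (le_integral_invRamp (Real.exp_pos (-1)) hb hb1.le) hB
    filter_upwards [(key (Real.exp_pos (-1))).eventually_const_lt (hbr.trans_le hint),
      eventually_gt_atTop 0] with x hxr hx
    exact hxr.trans_le (weightedHeatSum_le_card_div htop hx hb)
  · obtain ⟨a, har, ha0, ha⟩ := (((hlog.mono_left nhdsWithin_le_nhds).eventually_lt_const hr).and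
      ((eventually_gt_nhds (Real.exp_pos (-1))).filter_mono nhdsWithin_le_nhds |>.and
        (self_mem_nhdsWithin (s := Set.Iio (Real.exp (-1)))))).exists
    have hint := mul_le_mul_of_nonneg_left
      (integral_invRamp_le ha0 ha ((le_of_lt ha).trans hlt1.le)) hB
    filter_upwards [(key ha0).eventually_lt_const (hint.trans_lt har),
      eventually_gt_atTop 0] with x hxr hx
    exact (card_div_le_weightedHeatSum hpos htop hsum hx ha0 ha).trans_lt hxr
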